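/- arXiv:1103.3722 — 2 statements merged into one kernel-verified Lean document; each statement's English description precedes it below -/
import Mathlib

section
/- Second-order equivalence of ensembles in L² (Proposition 3.2, main estimate). Let ℓ₀ ∈ ℕ and let f : {0,1}^ℤ → ℝ be a local function with supp(f) ⊆ {1,…,ℓ₀}, and fix ρ ∈ (0,1). Then there exists a constant c = c(f,ρ) such that for every ℓ ≥ ℓ₀, ∫ ( ψ_f(ℓ;η) − φ_f(ρ) − φ_f'(ρ)(η^ℓ − ρ) − (φ_f''(ρ)/2)( (η^ℓ − ρ)² − χ(ρ)/ℓ ) )² dν_ρ(η) ≤ c/ℓ³. -/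
open MeasureTheory Finset

noncomputable section

/-- Configurations of the lattice gas: elements of `{0,1}^ℤ`, encoded as `ℤ → Bool`. -/
abbrev Cfg : Type := ℤ → Bool

/-- The configuration whose occupied sites are exactly the finite set `S`. -/
def cfgOf (S : Finset ℤ) : Cfg := fun z => decide (z ∈ S)

/-- `f` depends only on the coordinates in the finite set `A`
(i.e. `f` is local with `supp f ⊆ A`). -/
def LocalOn (A : Finset ℤ) (f : Cfg → ℝ) : Prop :=
  ∀ η ξ : Cfg, (∀ x ∈ A, η x = ξ x) → f η = f ξ

/-- `f` is a local function. -/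
def IsLocal (f : Cfg → ℝ) : Prop := ∃ A : Finset ℤ, LocalOn A f

/-- For `f` depending only on the coordinates in `A`, `phi A f β = ∫ f dν_β` where `ν_β`
is the Bernoulli product measure of density `β`; written as an explicit polynomial in `β`. -/
def phi (A : Finset ℤ) (f : Cfg → ℝ) (β : ℝ) : ℝ :=
  ∑ S ∈ A.powerset, β ^ S.card * (1 - β) ^ (A.card - S.card) * f (cfgOf S)

/-- `ψ_f(ℓ; m)`: the average of `f` over all configurations of `{1,…,ℓ}`
having exactly `m` particles. -/
def condAvg (ℓ m : ℕ) (f : Cfg → ℝ) : ℝ :=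
  (∑ S ∈ (Finset.Icc (1 : ℤ) (ℓ : ℤ)).powerset.filter (fun S => S.card = m), f (cfgOf S))
    / (ℓ.choose m : ℝ)

/-- `μ` is the product Bernoulli measure on `{0,1}^ℤ` of density `ρ`: it is a probability
measure under which the coordinates are i.i.d. with `μ(η x = 1) = ρ`. -/
def IsBernoulliProduct (ρ : ℝ) (μ : Measure Cfg) : Prop :=
  IsProbabilityMeasure μ ∧
    ∀ (A : Finset ℤ) (σ : Cfg),
      (μ {η : Cfg | ∀ x ∈ A, η x = σ x}).toReal
        = ∏ x ∈ A, (if σ x then ρ else 1 - ρ)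

/-- The number of particles of `η` in `{1,…,ℓ}`. -/
def numOnes (ℓ : ℕ) (η : Cfg) : ℕ := ∑ x ∈ Finset.Icc (1 : ℤ) (ℓ : ℤ), (η x).toNat

/-- The empirical density `η^ℓ` of particles in `{1,…,ℓ}`. -/
def empDens (ℓ : ℕ) (η : Cfg) : ℝ := (numOnes ℓ η : ℝ) / (ℓ : ℝ)

/-- `ψ_f(ℓ)`: the conditional expectation of `f` given the particle number in `{1,…,ℓ}`,
as a function on configurations. -/
def psiFun (ℓ : ℕ) (f : Cfg → ℝ) : Cfg → ℝ := fun η => condAvg ℓ (numOnes ℓ η) f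

/-- The variance of `g` with respect to the measure `μ`. -/
def Var (μ : Measure Cfg) (g : Cfg → ℝ) : ℝ := ∫ η, (g η - ∫ ξ, g ξ ∂μ) ^ 2 ∂μ

section Symmetrization

variable {α : Type*} [DecidableEq α]

/-- Two subsets of `A` of equal cardinality are exchanged by a permutation preserving `A`. -/
lemma exists_perm_map_eq {A T T' : Finset α} (hT : T ⊆ A) (hT' : T' ⊆ A)
    (h : T.card = T'.card) :
    ∃ σ : Equiv.Perm α, T.map σ.toEmbedding = T' ∧ A.map σ.toEmbedding = A := by
  have h1 : Nonempty ({x : A // x.1 ∈ T} ≃ {x : A // x.1 ∈ T'}) := by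
    have e1 : ∀ U : Finset α, U ⊆ A → Nonempty ({x : A // x.1 ∈ U} ≃ U) := fun U hU =>
      ⟨⟨fun x => ⟨x.1.1, x.2⟩, fun x => ⟨⟨x.1, hU x.2⟩, x.2⟩, fun _ => rfl, fun _ => rfl⟩⟩
    exact ⟨(e1 T hT).some.trans ((Finset.equivOfCardEq h).trans (e1 T' hT').some.symm)⟩
  obtain ⟨e⟩ := h1
  let τ : Equiv.Perm A := e.extendSubtype
  have hmem : ∀ x (hx : x ∈ A), τ.ofSubtype x = τ ⟨x, hx⟩ := fun x hx =>
    Equiv.Perm.ofSubtype_apply_of_mem τ hx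
  refine ⟨Equiv.Perm.ofSubtype τ, ?_, ?_⟩
  · apply Finset.eq_of_subset_of_card_le
    · intro y hy
      obtain ⟨x, hx, rfl⟩ := Finset.mem_map.1 hy
      have := e.extendSubtype_mem ⟨x, hT hx⟩ hx
      simpa [hmem x (hT hx)] using this
    · simp [h]
  · apply Finset.eq_of_subset_of_card_le
    · intro y hy
      obtain ⟨x, hx, rfl⟩ := Finset.mem_map.1 hy
      simp [hmem x hx]
    · simp

/-- If `g` is invariant under simultaneous permutations, the sum of `g T S` over the `m`-subsets
`S` of `A` depends on `T` only through its cardinality. -/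
lemma sum_powersetCard_eq_of_card_eq {g : Finset α → Finset α → ℝ}
    (hg : ∀ (σ : Equiv.Perm α) T S, g (T.map σ.toEmbedding) (S.map σ.toEmbedding) = g T S)
    {A T T' : Finset α} (hT : T ⊆ A) (hT' : T' ⊆ A) (h : T.card = T'.card) (m : ℕ) :
    ∑ S ∈ powersetCard m A, g T S = ∑ S ∈ powersetCard m A, g T' S := by
  obtain ⟨σ, rfl, hA⟩ := exists_perm_map_eq hT hT' h
  conv_rhs => rw [← hA, Finset.powersetCard_map, Finset.sum_map]
  exact Finset.sum_congr rfl fun S _ => (hg σ T S).symm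

/-- Averaging an invariant kernel over its second argument agrees with averaging it over its
first argument. -/
lemma choose_mul_sum_powersetCard_comm {g : Finset α → Finset α → ℝ}
    (hg : ∀ (σ : Equiv.Perm α) T S, g (T.map σ.toEmbedding) (S.map σ.toEmbedding) = g T S)
    {A T S : Finset α} (hT : T ⊆ A) (hS : S ⊆ A) :
    (A.card.choose T.card : ℝ) * ∑ S' ∈ powersetCard S.card A, g T S'
      = A.card.choose S.card * ∑ T' ∈ powersetCard T.card A, g T' S := by
  have h1 : ∑ T' ∈ powersetCard T.card A, ∑ S' ∈ powersetCard S.card A, g T' S'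
      = (A.card.choose T.card : ℝ) * ∑ S' ∈ powersetCard S.card A, g T S' := by
    rw [Finset.sum_congr rfl fun T' hT' => sum_powersetCard_eq_of_card_eq hg
      (Finset.mem_powersetCard.1 hT').1 hT (Finset.mem_powersetCard.1 hT').2 S.card]
    simp
  have h2 : ∑ S' ∈ powersetCard S.card A, ∑ T' ∈ powersetCard T.card A, g T' S'
      = (A.card.choose S.card : ℝ) * ∑ T' ∈ powersetCard T.card A, g T' S := by
    rw [Finset.sum_congr rfl fun S' hS' => sum_powersetCard_eq_of_card_eq
      (g := fun S T => g T S) (fun σ S T => hg σ T S)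
      (Finset.mem_powersetCard.1 hS').1 hS (Finset.mem_powersetCard.1 hS').2 T.card]
    simp
  rw [← h1, ← h2, Finset.sum_comm]

end Symmetrization

/-- The centred occupation variable `η(x) − ρ` of the configuration with occupied set `S`. -/
def centOcc (ρ : ℝ) (S : Finset ℤ) (x : ℤ) : ℝ := (if x ∈ S then 1 else 0) - ρ

lemma prod_centOcc_map (ρ : ℝ) (σ : Equiv.Perm ℤ) (T S : Finset ℤ) :
    ∏ x ∈ T.map σ.toEmbedding, centOcc ρ (S.map σ.toEmbedding) x = ∏ x ∈ T, centOcc ρ S x := by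
  simp [centOcc]

/-- The normalised elementary symmetric polynomial of degree `k` in the centred occupation
variables of the sites in `A`. -/
def symAvg (ρ : ℝ) (A : Finset ℤ) (k : ℕ) (S : Finset ℤ) : ℝ :=
  (∑ U ∈ powersetCard k A, ∏ x ∈ U, centOcc ρ S x) / A.card.choose k

lemma average_prod_centOcc (ρ : ℝ) {A T S : Finset ℤ} (hT : T ⊆ A) (hS : S ⊆ A) :
    (∑ S' ∈ powersetCard S.card A, ∏ x ∈ T, centOcc ρ S' x) / A.card.choose S.card
      = symAvg ρ A T.card S := by
  have hc := choose_mul_sum_powersetCard_comm (g := fun T S => ∏ x ∈ T, centOcc ρ S x)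
    (prod_centOcc_map ρ) hT hS
  have hS0 : (A.card.choose S.card : ℝ) ≠ 0 := by
    exact_mod_cast (Nat.choose_pos (Finset.card_le_card hS)).ne'
  have hT0 : (A.card.choose T.card : ℝ) ≠ 0 := by
    exact_mod_cast (Nat.choose_pos (Finset.card_le_card hT)).ne'
  rw [symAvg, div_eq_div_iff hS0 hT0]
  linarith

lemma symAvg_zero (ρ : ℝ) (A S : Finset ℤ) : symAvg ρ A 0 S = 1 := by simp [symAvg]

lemma sum_centOcc (ρ : ℝ) {A S : Finset ℤ} (hS : S ⊆ A) :
    ∑ x ∈ A, centOcc ρ S x = S.card - A.card * ρ := by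
  simp [centOcc, Finset.sum_sub_distrib, Finset.inter_eq_right.2 hS]

lemma symAvg_one (ρ : ℝ) {A S : Finset ℤ} (hS : S ⊆ A) (hA : A.Nonempty) :
    symAvg ρ A 1 S = S.card / A.card - ρ := by
  have : (A.card : ℝ) ≠ 0 := by exact_mod_cast hA.card_pos.ne'
  rw [symAvg, Finset.powersetCard_one, Finset.sum_map]
  simp [sum_centOcc ρ hS]
  field_simp

lemma two_mul_sum_powersetCard_two (v : ℤ → ℝ) (A : Finset ℤ) :
    2 * ∑ U ∈ powersetCard 2 A, ∏ x ∈ U, v x = (∑ x ∈ A, v x) ^ 2 - ∑ x ∈ A, v x ^ 2 := by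
  induction A using Finset.induction_on with
  | empty => rw [Finset.powersetCard_eq_empty.2 (by simp)]; simp
  | insert a A ha ih =>
    rw [Finset.powersetCard_succ_insert ha, Finset.sum_union, Finset.sum_image,
      Finset.powersetCard_one, Finset.sum_map, Finset.sum_insert ha, Finset.sum_insert ha,
      mul_add, ih]
    · have : ∑ x ∈ A, ∏ y ∈ insert a {x}, v y = v a * ∑ x ∈ A, v x := by
        rw [Finset.mul_sum]
        refine Finset.sum_congr rfl fun x hx => ?_
        rw [Finset.prod_insert (by rintro h; simp at h; exact ha (h ▸ hx)), Finset.prod_singleton]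
      simp only [Function.Embedding.coeFn_mk]
      rw [this]; ring
    · intro U hU V hV h
      have h1 : a ∉ U := fun h => ha ((Finset.mem_powersetCard.1 hU).1 h)
      have h2 : a ∉ V := fun h => ha ((Finset.mem_powersetCard.1 hV).1 h)
      simpa [h1, h2] using congrArg (Finset.erase · a) h
    · rw [Finset.disjoint_left]
      intro U hU hU'
      obtain ⟨V, -, rfl⟩ := Finset.mem_image.1 hU'
      exact ha ((Finset.mem_powersetCard.1 hU).1 (by simp))

lemma symAvg_two_sub (ρ : ℝ) {A S : Finset ℤ} (hS : S ⊆ A) (hA : 2 ≤ A.card) :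
    symAvg ρ A 2 S - ((S.card / A.card - ρ) ^ 2 - ρ * (1 - ρ) / A.card)
      = (symAvg ρ A 2 S - (1 - 2 * ρ) * symAvg ρ A 1 S) / A.card := by
  have hA0 : (2 : ℝ) ≤ A.card := by exact_mod_cast hA
  have hsq : ∑ x ∈ A, centOcc ρ S x ^ 2
      = A.card * (ρ * (1 - ρ)) + (1 - 2 * ρ) * ∑ x ∈ A, centOcc ρ S x := by
    rw [Finset.mul_sum, ← nsmul_eq_mul, ← Finset.sum_const, ← Finset.sum_add_distrib]
    refine Finset.sum_congr rfl fun x _ => ?_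
    unfold centOcc
    split_ifs <;> ring
  have h2 := two_mul_sum_powersetCard_two (centOcc ρ S) A
  rw [hsq, sum_centOcc ρ hS] at h2
  rw [symAvg_one ρ hS (Finset.card_pos.1 (by omega)), symAvg, Nat.cast_choose_two]
  have h3 : ∑ U ∈ powersetCard 2 A, ∏ x ∈ U, centOcc ρ S x = ((S.card - A.card * ρ) ^ 2 -
      (A.card * (ρ * (1 - ρ)) + (1 - 2 * ρ) * (S.card - A.card * ρ))) / 2 := by linarith
  rw [h3]
  have : (A.card : ℝ) ≠ 0 := by linarith
  have : (A.card : ℝ) - 1 ≠ 0 := by linarith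
  field_simp
  ring

/-- The probability that the sites of `A` occupied under the Bernoulli product measure of
density `ρ` are exactly those of `S ⊆ A`. -/
def bernWeight (ρ : ℝ) (A S : Finset ℤ) : ℝ := ∏ x ∈ A, if x ∈ S then ρ else 1 - ρ

lemma bernWeight_nonneg {ρ : ℝ} (hρ : ρ ∈ Set.Ioo (0 : ℝ) 1) (A S : Finset ℤ) :
    0 ≤ bernWeight ρ A S := by
  refine Finset.prod_nonneg fun x _ => ?_
  split_ifs <;> linarith [hρ.1, hρ.2]

/-- The integral of a local function is a finite weighted sum. -/
lemma integral_eq_sum_bernWeight {ρ : ℝ} {μ : Measure Cfg} (hμ : IsBernoulliProduct ρ μ)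
    {A : Finset ℤ} {g : Cfg → ℝ} (hg : LocalOn A g) :
    ∫ η, g η ∂μ = ∑ S ∈ A.powerset, bernWeight ρ A S * g (cfgOf S) := by
  have := hμ.1
  let C : Finset ℤ → Set Cfg := fun S => {η | ∀ x ∈ A, η x = cfgOf S x}
  have hC : ∀ S, MeasurableSet (C S) := fun S => by
    have : C S = ⋂ x ∈ A, {η : Cfg | η x = cfgOf S x} := by ext; simp [C]
    rw [this]
    exact Finset.measurableSet_biInter _ fun x _ =>
      (measurable_pi_apply x) (measurableSet_singleton _)
  have hdec : ∀ η, g η = ∑ S ∈ A.powerset, (C S).indicator (fun _ => g (cfgOf S)) η := by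
    intro η
    rw [Finset.sum_eq_single (A.filter fun x => η x = true)]
    · have hη : ∀ x ∈ A, η x = cfgOf (A.filter fun x => η x = true) x := by
        intro x hx
        simp [cfgOf, hx]
      rw [Set.indicator_of_mem (s := C _) hη]
      exact hg _ _ hη
    · intro S hS hne
      refine Set.indicator_of_notMem (fun h => hne ?_) _
      ext x
      by_cases hx : x ∈ A
      · simp [hx, h x hx, cfgOf]
      · have : x ∉ S := fun h => hx (Finset.mem_powerset.1 hS h)
        simp [hx, this]
    · intro h
      simp at h
  rw [integral_congr_ae (.of_forall hdec), integral_finsetSum]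
  · refine Finset.sum_congr rfl fun S hS => ?_
    rw [integral_indicator_const _ (hC S), smul_eq_mul]
    congr 1
    have := hμ.2 A (cfgOf S)
    simpa [C, cfgOf, bernWeight, Measure.real] using this
  · exact fun S _ => (integrable_const _).indicator (hC S)

/-- Products of centred occupation variables are orthogonal. -/
lemma sum_bernWeight_prod_mul_prod (ρ : ℝ) {A U V : Finset ℤ} (hU : U ⊆ A) (hV : V ⊆ A) :
    ∑ S ∈ A.powerset, bernWeight ρ A S * ((∏ x ∈ U, centOcc ρ S x) * ∏ x ∈ V, centOcc ρ S x)
      = if U = V then (ρ * (1 - ρ)) ^ U.card else 0 := by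
  let e : ℝ → ℤ → ℝ := fun a x => (if x ∈ U then a else 1) * (if x ∈ V then a else 1)
  have h1 : ∀ S ∈ A.powerset, bernWeight ρ A S *
      ((∏ x ∈ U, centOcc ρ S x) * ∏ x ∈ V, centOcc ρ S x)
      = (∏ x ∈ S, ρ * e (1 - ρ) x) * ∏ x ∈ A \ S, (1 - ρ) * e (-ρ) x := by
    intro S hS
    have hSA := Finset.mem_powerset.1 hS
    have h2 : ∀ W ⊆ A, ∏ x ∈ W, centOcc ρ S x = ∏ x ∈ A, if x ∈ W then centOcc ρ S x else 1 :=
      fun W hW => by rw [Finset.prod_ite_mem, Finset.inter_eq_right.2 hW]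
    rw [h2 U hU, h2 V hV, bernWeight, ← Finset.prod_mul_distrib, ← Finset.prod_mul_distrib,
      ← Finset.prod_sdiff hSA, mul_comm]
    congr 1
    · refine Finset.prod_congr rfl fun x hx => ?_
      simp [centOcc, hx, e]
    · refine Finset.prod_congr rfl fun x hx => ?_
      by_cases hxU : x ∈ U <;> by_cases hxV : x ∈ V <;>
        simp [centOcc, (Finset.mem_sdiff.1 hx).2, e, hxU, hxV]
  rw [Finset.sum_congr rfl h1, ← Finset.prod_add]
  split_ifs with h
  · subst h
    have hpow : ∏ x ∈ A, (if x ∈ U then ρ * (1 - ρ) else 1) = (ρ * (1 - ρ)) ^ U.card := by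
      rw [Finset.prod_ite_mem, Finset.inter_eq_right.2 hU, Finset.prod_const]
    rw [← hpow]
    refine Finset.prod_congr rfl fun x _ => ?_
    by_cases hx : x ∈ U <;> simp [e, hx]
    ring
  · obtain ⟨x, hx⟩ : ∃ x, ¬ (x ∈ U ↔ x ∈ V) := by
      by_contra! hc
      exact h (Finset.ext hc)
    refine Finset.prod_eq_zero (i := x) ?_ ?_
    · by_cases hxU : x ∈ U
      · exact hU hxU
      · exact hV (by tauto)
    · by_cases hxU : x ∈ U <;> by_cases hxV : x ∈ V <;> simp [e, hxU, hxV] at hx ⊢ <;> ring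

lemma sum_bernWeight_symAvg_sq (ρ : ℝ) {A : Finset ℤ} {k : ℕ} (hk : k ≤ A.card) :
    ∑ S ∈ A.powerset, bernWeight ρ A S * symAvg ρ A k S ^ 2
      = (ρ * (1 - ρ)) ^ k / A.card.choose k := by
  have hC : (A.card.choose k : ℝ) ≠ 0 := by exact_mod_cast (Nat.choose_pos hk).ne'
  have h1 : ∀ S, bernWeight ρ A S * symAvg ρ A k S ^ 2 = (∑ U ∈ powersetCard k A,
      ∑ V ∈ powersetCard k A, bernWeight ρ A S *
        ((∏ x ∈ U, centOcc ρ S x) * ∏ x ∈ V, centOcc ρ S x)) / (A.card.choose k : ℝ) ^ 2 := by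
    intro S
    simp_rw [← Finset.mul_sum, ← Finset.sum_mul]
    rw [symAvg, div_pow]
    ring
  simp_rw [h1]
  rw [← Finset.sum_div, Finset.sum_comm]
  have h2 : ∀ U ∈ powersetCard k A, ∑ S ∈ A.powerset, ∑ V ∈ powersetCard k A, bernWeight ρ A S *
        ((∏ x ∈ U, centOcc ρ S x) * ∏ x ∈ V, centOcc ρ S x) = (ρ * (1 - ρ)) ^ k := by
    intro U hU
    have hU' := Finset.mem_powersetCard.1 hU
    rw [Finset.sum_comm, Finset.sum_congr rfl fun V hV =>
      sum_bernWeight_prod_mul_prod ρ hU'.1 (Finset.mem_powersetCard.1 hV).1]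
    rw [Finset.sum_ite_eq, if_pos hU, hU'.2]
  rw [Finset.sum_congr rfl h2]
  simp
  field_simp

lemma sum_bernWeight_symAvg_sq_le {ρ : ℝ} (hρ : ρ ∈ Set.Ioo (0 : ℝ) 1) {A : Finset ℤ} {k j : ℕ}
    (hk : k ≤ A.card) (hjk : j ≤ k) (hA : 0 < A.card) :
    ∑ S ∈ A.powerset, bernWeight ρ A S * symAvg ρ A k S ^ 2
      ≤ (k ^ k * k.factorial : ℝ) / A.card ^ j := by
  rw [sum_bernWeight_symAvg_sq ρ hk]
  have h1 : (ρ * (1 - ρ)) ^ k ≤ 1 := by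
    apply pow_le_one₀ <;> nlinarith [hρ.1, hρ.2]
  have h2 : A.card ^ j ≤ k ^ k * k.factorial * A.card.choose k := by
    calc A.card ^ j ≤ A.card ^ k := Nat.pow_le_pow_right hA hjk
      _ ≤ (k * (A.card + 1 - k)) ^ k := by
          rcases Nat.eq_zero_or_pos k with rfl | hk0
          · simp
          · apply Nat.pow_le_pow_left
            obtain ⟨d, hd⟩ := Nat.exists_eq_add_of_le hk
            rw [hd, show k + d + 1 - k = d + 1 by omega]
            nlinarith
      _ = k ^ k * (A.card + 1 - k) ^ k := mul_pow _ _ _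
      _ ≤ k ^ k * (A.card.descFactorial k) :=
          Nat.mul_le_mul_left _ (Nat.pow_sub_le_descFactorial _ _)
      _ = _ := by rw [Nat.descFactorial_eq_factorial_mul_choose]; ring
  have hC : (0 : ℝ) < A.card.choose k := by exact_mod_cast Nat.choose_pos hk
  have hA' : (0 : ℝ) < A.card := by exact_mod_cast hA
  rw [div_le_div_iff₀ hC (by positivity)]
  have h2' : (A.card : ℝ) ^ j ≤ k ^ k * k.factorial * A.card.choose k := by exact_mod_cast h2
  calc (ρ * (1 - ρ)) ^ k * (A.card : ℝ) ^ j ≤ 1 * (A.card : ℝ) ^ j := by gcongr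
    _ ≤ _ := by rw [one_mul]; exact h2'

/-- Expansion of a local function in centred occupation variables: the same coefficients serve
every choice of the one-site expectations `u`. -/
lemma exists_coeff_centred (ρ : ℝ) (A : Finset ℤ) (g : Finset ℤ → ℝ) :
    ∃ c : Finset ℤ → ℝ, ∀ u : ℤ → ℝ,
      ∑ S ∈ A.powerset, ((∏ x ∈ S, u x) * ∏ x ∈ A \ S, (1 - u x)) * g S
        = ∑ T ∈ A.powerset, c T * ∏ x ∈ T, (u x - ρ) := by
  refine ⟨fun T => ∑ S ∈ A.powerset, g S * ((∏ x ∈ T, if x ∈ S then (1 : ℝ) else -1) *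
    ∏ x ∈ A \ T, if x ∈ S then ρ else 1 - ρ), fun u => ?_⟩
  have h1 : ∀ S ∈ A.powerset, (∏ x ∈ S, u x) * ∏ x ∈ A \ S, (1 - u x)
      = ∑ T ∈ A.powerset, (∏ x ∈ T, (if x ∈ S then (1 : ℝ) else -1) * (u x - ρ)) *
          ∏ x ∈ A \ T, if x ∈ S then ρ else 1 - ρ := by
    intro S hS
    rw [← Finset.prod_add, ← Finset.prod_sdiff (Finset.mem_powerset.1 hS), mul_comm]
    congr 1
    · refine Finset.prod_congr rfl fun x hx => ?_
      simp only [(Finset.mem_sdiff.1 hx).2, if_false]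
      ring
    · refine Finset.prod_congr rfl fun x hx => ?_
      simp [hx]
  rw [Finset.sum_congr rfl fun S hS => congrArg (· * g S) (h1 S hS)]
  simp_rw [Finset.sum_mul]
  rw [Finset.sum_comm]
  refine Finset.sum_congr rfl fun T _ => Finset.sum_congr rfl fun S _ => ?_
  rw [Finset.prod_mul_distrib]
  ring

/-- A local function and its Bernoulli expectation share an expansion around density `ρ`. -/
lemma exists_expansion (ρ : ℝ) {A : Finset ℤ} {f : Cfg → ℝ} (hf : LocalOn A f) :
    ∃ c : Finset ℤ → ℝ,
      (∀ β, phi A f β = ∑ T ∈ A.powerset, c T * (β - ρ) ^ T.card) ∧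
      ∀ S, f (cfgOf S) = ∑ T ∈ A.powerset, c T * ∏ x ∈ T, centOcc ρ S x := by
  obtain ⟨c, hc⟩ := exists_coeff_centred ρ A fun S => f (cfgOf S)
  refine ⟨c, fun β => ?_, fun S => ?_⟩
  · have h := hc fun _ => β
    simp only [Finset.prod_const] at h
    rw [← h, phi]
    refine Finset.sum_congr rfl fun S hS => ?_
    rw [Finset.card_sdiff_of_subset (Finset.mem_powerset.1 hS)]
  · have h := hc fun x => if x ∈ S then 1 else 0
    simp only [centOcc]
    rw [← h, Finset.sum_eq_single (A ∩ S)]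
    · rw [Finset.prod_eq_one, Finset.prod_eq_one, hf (cfgOf S) (cfgOf (A ∩ S))]
      · ring
      · intro x hx
        simp [cfgOf, hx]
      · intro x hx
        simp only [Finset.mem_sdiff, Finset.mem_inter, not_and] at hx
        simp [hx.2 hx.1]
      · intro x hx
        simp [(Finset.mem_inter.1 hx).2]
    · intro S' hS' hne
      have hsub := Finset.mem_powerset.1 hS'
      obtain ⟨x, hx⟩ : ∃ x, ¬ (x ∈ S' ↔ x ∈ A ∩ S) := by
        by_contra! hcon
        exact hne (Finset.ext hcon)
      by_cases hxS : x ∈ S'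
      · have : x ∉ S := fun h => hx ⟨fun _ => Finset.mem_inter.2 ⟨hsub hxS, h⟩, fun _ => hxS⟩
        rw [Finset.prod_eq_zero hxS (by simp [this])]
        ring
      · have hxAS : x ∈ A ∩ S := by tauto
        rw [Finset.prod_eq_zero (s := A \ S') (i := x)
          (Finset.mem_sdiff.2 ⟨(Finset.mem_inter.1 hxAS).1, hxS⟩)
          (by simp [(Finset.mem_inter.1 hxAS).2])]
        ring
    · intro h
      simp at h

lemma numOnes_congr {ℓ : ℕ} {η ξ : Cfg} (h : ∀ x ∈ Finset.Icc (1 : ℤ) ℓ, η x = ξ x) :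
    numOnes ℓ η = numOnes ℓ ξ :=
  Finset.sum_congr rfl fun x hx => by rw [h x hx]

lemma numOnes_cfgOf {ℓ : ℕ} {S : Finset ℤ} (hS : S ⊆ Finset.Icc (1 : ℤ) ℓ) :
    numOnes ℓ (cfgOf S) = S.card := by
  have h : ∀ x, (cfgOf S x).toNat = if x ∈ S then 1 else 0 := by
    intro x
    by_cases hx : x ∈ S <;> simp [cfgOf, hx]
  simp_rw [numOnes, h]
  simp [Finset.inter_eq_right.2 hS]

/-- The error of the second-order expansion of the symmetric average of degree `k`. -/
def expansionError (ρ : ℝ) (A : Finset ℤ) (k : ℕ) (S : Finset ℤ) : ℝ :=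
  symAvg ρ A k S - 0 ^ k - k * 0 ^ (k - 1) * (S.card / A.card - ρ)
    - k * (k - 1 : ℕ) * 0 ^ (k - 2) / 2 * ((S.card / A.card - ρ) ^ 2 - ρ * (1 - ρ) / A.card)

lemma exists_sum_expansionError_sq_le {ρ : ℝ} (hρ : ρ ∈ Set.Ioo (0 : ℝ) 1) (k : ℕ) :
    ∃ C : ℝ, ∀ A : Finset ℤ, k ≤ A.card → 0 < A.card →
      ∑ S ∈ A.powerset, bernWeight ρ A S * expansionError ρ A k S ^ 2 ≤ C / A.card ^ 3 := by
  match k with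
  | 0 =>
    refine ⟨0, fun A _ _ => ?_⟩
    simp [expansionError, symAvg_zero]
  | 1 =>
    refine ⟨0, fun A _ hA => ?_⟩
    rw [Finset.sum_congr rfl (g := fun _ => 0)]
    · simp
    · intro S hS
      simp [expansionError, symAvg_one ρ (Finset.mem_powerset.1 hS) (Finset.card_pos.1 hA)]
  | 2 =>
    refine ⟨2 * (2 ^ 2 * (2 : ℕ).factorial + (1 - 2 * ρ) ^ 2), fun A hA2 hA => ?_⟩
    have hA' : (0 : ℝ) < A.card := by exact_mod_cast hA
    have h2 := sum_bernWeight_symAvg_sq_le hρ hA2 one_le_two hA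
    have h1 := sum_bernWeight_symAvg_sq_le hρ (show 1 ≤ A.card from hA) le_rfl hA
    simp only [Nat.cast_ofNat, Nat.cast_one, Nat.factorial_one, pow_one, mul_one] at h1 h2
    calc ∑ S ∈ A.powerset, bernWeight ρ A S * expansionError ρ A 2 S ^ 2
        ≤ ∑ S ∈ A.powerset, (2 / (A.card : ℝ) ^ 2) * (bernWeight ρ A S * symAvg ρ A 2 S ^ 2
            + (1 - 2 * ρ) ^ 2 * (bernWeight ρ A S * symAvg ρ A 1 S ^ 2)) := by
          refine Finset.sum_le_sum fun S hS => ?_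
          have he : expansionError ρ A 2 S
              = (symAvg ρ A 2 S - (1 - 2 * ρ) * symAvg ρ A 1 S) / A.card := by
            rw [← symAvg_two_sub ρ (Finset.mem_powerset.1 hS) hA2]
            simp [expansionError]
          have hsq : (symAvg ρ A 2 S - (1 - 2 * ρ) * symAvg ρ A 1 S) ^ 2
              ≤ 2 * (symAvg ρ A 2 S ^ 2 + (1 - 2 * ρ) ^ 2 * symAvg ρ A 1 S ^ 2) := by
            nlinarith [sq_nonneg (symAvg ρ A 2 S + (1 - 2 * ρ) * symAvg ρ A 1 S)]
          have hw := bernWeight_nonneg hρ A S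
          calc bernWeight ρ A S * expansionError ρ A 2 S ^ 2
              = bernWeight ρ A S * ((symAvg ρ A 2 S - (1 - 2 * ρ) * symAvg ρ A 1 S) ^ 2
                  / (A.card : ℝ) ^ 2) := by rw [he, div_pow]
            _ ≤ bernWeight ρ A S * (2 * (symAvg ρ A 2 S ^ 2
                  + (1 - 2 * ρ) ^ 2 * symAvg ρ A 1 S ^ 2) / (A.card : ℝ) ^ 2) := by gcongr
            _ = _ := by ring
      _ = (2 / (A.card : ℝ) ^ 2) * (∑ S ∈ A.powerset, bernWeight ρ A S * symAvg ρ A 2 S ^ 2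
            + (1 - 2 * ρ) ^ 2 * ∑ S ∈ A.powerset, bernWeight ρ A S * symAvg ρ A 1 S ^ 2) := by
          rw [← Finset.mul_sum, Finset.sum_add_distrib, ← Finset.mul_sum]
      _ ≤ (2 / (A.card : ℝ) ^ 2) * ((2 ^ 2 * (2 : ℕ).factorial : ℝ) / A.card
            + (1 - 2 * ρ) ^ 2 * (1 / A.card)) := by gcongr
      _ = _ := by
          field_simp
  | k + 3 =>
    refine ⟨((k + 3 : ℕ) : ℝ) ^ (k + 3) * (k + 3).factorial, fun A hk hA => ?_⟩
    simpa [expansionError] using sum_bernWeight_symAvg_sq_le hρ hk (show 3 ≤ k + 3 by omega) hA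

lemma deriv_sum_mul_sub_pow (s : Finset (Finset ℤ)) (c : Finset ℤ → ℝ) (e : Finset ℤ → ℕ)
    (ρ : ℝ) : deriv (fun β => ∑ T ∈ s, c T * (β - ρ) ^ e T)
      = fun β => ∑ T ∈ s, c T * e T * (β - ρ) ^ (e T - 1) := by
  ext β
  refine HasDerivAt.deriv (HasDerivAt.fun_sum fun T _ => ?_)
  have h := (((hasDerivAt_id β).sub_const ρ).pow (e T)).const_mul (c T)
  simpa [mul_assoc] using h

lemma condAvg_eq_sum_symAvg {ρ : ℝ} {A₀ : Finset ℤ} {f : Cfg → ℝ} {c : Finset ℤ → ℝ}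
    (hc : ∀ S, f (cfgOf S) = ∑ T ∈ A₀.powerset, c T * ∏ x ∈ T, centOcc ρ S x)
    {ℓ : ℕ} (hA : A₀ ⊆ Finset.Icc (1 : ℤ) ℓ) {S : Finset ℤ} (hS : S ⊆ Finset.Icc (1 : ℤ) ℓ) :
    condAvg ℓ S.card f = ∑ T ∈ A₀.powerset, c T * symAvg ρ (Finset.Icc (1 : ℤ) ℓ) T.card S := by
  have hcard : (Finset.Icc (1 : ℤ) ℓ).card = ℓ := by simp
  rw [condAvg, ← Finset.powersetCard_eq_filter]
  simp_rw [hc]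
  rw [Finset.sum_comm, Finset.sum_div]
  refine Finset.sum_congr rfl fun T hT => ?_
  rw [← average_prod_centOcc ρ ((Finset.mem_powerset.1 hT).trans hA) hS, ← Finset.mul_sum, hcard,
    mul_div_assoc]

/-- **Second-order equivalence of ensembles in L²** (Proposition 3.2, main estimate).
If `f` is local with support in `{1,…,ℓ₀}` and `ρ ∈ (0,1)`, there is a constant
`c = c(f,ρ)` such that for every `ℓ ≥ ℓ₀`,
`∫ (ψ_f(ℓ;η) − φ_f(ρ) − φ_f'(ρ)(η^ℓ−ρ) − (φ_f''(ρ)/2)((η^ℓ−ρ)² − χ(ρ)/ℓ))² dν_ρ ≤ c/ℓ³`. -/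
theorem second_order_equivalence_of_ensembles
    (ℓ₀ : ℕ) (f : Cfg → ℝ) (hf : LocalOn (Finset.Icc (1 : ℤ) (ℓ₀ : ℤ)) f)
    (ρ : ℝ) (hρ : ρ ∈ Set.Ioo (0 : ℝ) 1) :
    ∃ c : ℝ, ∀ μ : Measure Cfg, IsBernoulliProduct ρ μ → ∀ ℓ : ℕ, ℓ₀ ≤ ℓ →
      ∫ η, (psiFun ℓ f η - phi (Finset.Icc (1 : ℤ) (ℓ₀ : ℤ)) f ρ
            - deriv (phi (Finset.Icc (1 : ℤ) (ℓ₀ : ℤ)) f) ρ * (empDens ℓ η - ρ)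
            - deriv (deriv (phi (Finset.Icc (1 : ℤ) (ℓ₀ : ℤ)) f)) ρ / 2
                * ((empDens ℓ η - ρ) ^ 2 - ρ * (1 - ρ) / (ℓ : ℝ))) ^ 2 ∂μ
        ≤ c / (ℓ : ℝ) ^ 3 := by
  obtain ⟨c, hphi, hc⟩ := exists_expansion ρ hf
  set A₀ := Finset.Icc (1 : ℤ) (ℓ₀ : ℤ) with hA₀
  choose C hC using exists_sum_expansionError_sq_le hρ
  have hphi' : phi A₀ f = fun β => ∑ T ∈ A₀.powerset, c T * (β - ρ) ^ T.card := funext hphi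
  have hd1 := deriv_sum_mul_sub_pow A₀.powerset c Finset.card ρ
  have hd2 := deriv_sum_mul_sub_pow A₀.powerset (fun T => c T * T.card) (fun T => T.card - 1) ρ
  refine ⟨A₀.powerset.card * ∑ T ∈ A₀.powerset, c T ^ 2 * C T.card, fun μ hμ ℓ hℓ => ?_⟩
  set A := Finset.Icc (1 : ℤ) (ℓ : ℤ) with hA
  have hcard : A.card = ℓ := by simp [hA]
  have hsub : A₀ ⊆ A := Finset.Icc_subset_Icc_right (by exact_mod_cast hℓ)
  rw [integral_eq_sum_bernWeight hμ (A := A)]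
  swap
  · intro η ξ h
    simp only [psiFun, empDens, numOnes_congr h]
  have hval : ∀ S ∈ A.powerset, psiFun ℓ f (cfgOf S) - phi A₀ f ρ
      - deriv (phi A₀ f) ρ * (empDens ℓ (cfgOf S) - ρ)
      - deriv (deriv (phi A₀ f)) ρ / 2
        * ((empDens ℓ (cfgOf S) - ρ) ^ 2 - ρ * (1 - ρ) / (ℓ : ℝ))
      = ∑ T ∈ A₀.powerset, c T * expansionError ρ A T.card S := by
    intro S hS
    have hS' := Finset.mem_powerset.1 hS
    rw [psiFun, empDens, numOnes_cfgOf hS', condAvg_eq_sum_symAvg hc hsub hS', hphi', hd1, hd2]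
    simp only [sub_self, expansionError, hcard]
    rw [Finset.sum_mul, Finset.sum_div, Finset.sum_mul, ← Finset.sum_sub_distrib,
      ← Finset.sum_sub_distrib, ← Finset.sum_sub_distrib]
    refine Finset.sum_congr rfl fun T _ => ?_
    rw [Nat.sub_sub]
    ring
  rw [Finset.sum_congr rfl fun S hS => by rw [hval S hS]]
  rcases Nat.eq_zero_or_pos ℓ with rfl | hpos
  · have hA0 : A = ∅ := by simp [hA]
    have hA₀0 : A₀ = ∅ := Finset.subset_empty.1 (hA0 ▸ hsub)
    simp [hA0, hA₀0, expansionError, symAvg_zero]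
  · calc ∑ S ∈ A.powerset, bernWeight ρ A S
          * (∑ T ∈ A₀.powerset, c T * expansionError ρ A T.card S) ^ 2
        ≤ ∑ S ∈ A.powerset, bernWeight ρ A S
          * (A₀.powerset.card * ∑ T ∈ A₀.powerset, (c T * expansionError ρ A T.card S) ^ 2) :=
          Finset.sum_le_sum fun S _ => mul_le_mul_of_nonneg_left sq_sum_le_card_mul_sum_sq
            (bernWeight_nonneg hρ A S)
      _ = A₀.powerset.card * ∑ T ∈ A₀.powerset, c T ^ 2
          * ∑ S ∈ A.powerset, bernWeight ρ A S * expansionError ρ A T.card S ^ 2 := by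
          simp_rw [Finset.mul_sum]
          rw [Finset.sum_comm]
          refine Finset.sum_congr rfl fun T _ => Finset.sum_congr rfl fun S _ => ?_
          ring
      _ ≤ A₀.powerset.card * ∑ T ∈ A₀.powerset, c T ^ 2 * (C T.card / (ℓ : ℝ) ^ 3) := by
          gcongr with T hT
          have h := hC T.card A (Finset.card_le_card ((Finset.mem_powerset.1 hT).trans hsub))
            (hcard ▸ hpos)
          rwa [hcard] at h
      _ = _ := by
          rw [mul_div_assoc, Finset.sum_div]
          simp_rw [mul_div_assoc]
end
end

section
/- Renormalization variance bound for doubled blocks. Let ℓ₀ ∈ ℕ, let f : {0,1}^ℤ → ℝ be a local function with supp(f) ⊆ {1,…,ℓ₀}, and fix ρ ∈ (0,1) with φ_f(ρ) = 0. Then there exists a constant c = c(f,ρ) such that for every ℓ ≥ ℓ₀: Var(ψ_f(ℓ) − ψ_f(2ℓ); ν_ρ) ≤ c/ℓ; and if in addition φ_f'(ρ) = 0, then Var(ψ_f(ℓ) − ψ_f(2ℓ); ν_ρ) ≤ c/ℓ². -/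
open MeasureTheory Finset

noncomputable section

/-- The occupation variable of `η` at `x`, centred at density `ρ`. -/
def centredOcc (ρ : ℝ) (η : Cfg) (x : ℤ) : ℝ := if η x then 1 - ρ else -ρ

/-- The coefficient of `∏ x ∈ T, (η x - ρ)` in the expansion of the indicator of `S` on `A`. -/
def indicatorCoeff (ρ : ℝ) (A S T : Finset ℤ) : ℝ :=
  (∏ x ∈ T, if x ∈ S then (1 : ℝ) else -1) * ∏ x ∈ A \ T, if x ∈ S then ρ else 1 - ρ

/-- The total coefficient of degree `k` of `f` in the basis of products of centred occupations. -/
def degreeCoeff (ρ : ℝ) (A : Finset ℤ) (f : Cfg → ℝ) (k : ℕ) : ℝ :=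
  ∑ T ∈ A.powersetCard k, ∑ S ∈ A.powerset, f (cfgOf S) * indicatorCoeff ρ A S T

/-- The elementary symmetric polynomial of degree `k` in the centred occupations of `A`. -/
def centredEsymm (ρ : ℝ) (A : Finset ℤ) (k : ℕ) (η : Cfg) : ℝ :=
  ∑ B ∈ A.powersetCard k, ∏ x ∈ B, centredOcc ρ η x

/-- The set of occupied sites of `η` in `A`. -/
def occupied (A : Finset ℤ) (η : Cfg) : Finset ℤ := A.filter (fun x => η x = true)

lemma cfgOf_occupied (A : Finset ℤ) (η : Cfg) : ∀ x ∈ A, cfgOf (occupied A η) x = η x := by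
  intro x hx
  cases h : η x <;> simp [cfgOf, occupied, hx, h]

lemma card_occupied (ℓ : ℕ) (η : Cfg) : (occupied (Icc 1 (ℓ : ℤ)) η).card = numOnes ℓ η := by
  rw [occupied, numOnes, card_filter]
  refine sum_congr rfl fun x _ => ?_
  cases η x <;> simp

lemma prod_indicator_eq_sum (ρ : ℝ) (A S : Finset ℤ) (z : ℤ → ℝ) :
    ∏ x ∈ A, (if x ∈ S then ρ + z x else 1 - (ρ + z x))
      = ∑ T ∈ A.powerset, indicatorCoeff ρ A S T * ∏ x ∈ T, z x := by
  have h : ∀ x ∈ A, (if x ∈ S then ρ + z x else 1 - (ρ + z x))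
      = (if x ∈ S then (1 : ℝ) else -1) * z x + (if x ∈ S then ρ else 1 - ρ) := by
    intro x _
    split_ifs <;> ring
  rw [prod_congr rfl h, prod_add]
  refine sum_congr rfl fun T _ => ?_
  rw [prod_mul_distrib, indicatorCoeff]
  ring

lemma phi_eq_sum_prod (A : Finset ℤ) (f : Cfg → ℝ) (β : ℝ) :
    phi A f β = ∑ S ∈ A.powerset, f (cfgOf S) * ∏ x ∈ A, (if x ∈ S then β else 1 - β) := by
  refine sum_congr rfl fun S hS => ?_
  have hS := mem_powerset.1 hS
  rw [prod_ite, prod_const, prod_const, filter_mem_eq_inter, inter_eq_right.2 hS,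
    filter_notMem_eq_sdiff, card_sdiff_of_subset hS]
  ring

lemma phi_eq_sum_degreeCoeff (ρ : ℝ) (A : Finset ℤ) (f : Cfg → ℝ) (β : ℝ) :
    phi A f β = ∑ k ∈ range (A.card + 1), degreeCoeff ρ A f k * (β - ρ) ^ k := by
  have h : ∀ S ∈ A.powerset, f (cfgOf S) * ∏ x ∈ A, (if x ∈ S then β else 1 - β)
      = ∑ T ∈ A.powerset, f (cfgOf S) * indicatorCoeff ρ A S T * (β - ρ) ^ T.card := by
    intro S _
    have := prod_indicator_eq_sum ρ A S (fun _ => β - ρ)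
    simp only [add_sub_cancel, prod_const] at this
    rw [this, mul_sum]
    exact sum_congr rfl fun T _ => by ring
  rw [phi_eq_sum_prod, sum_congr rfl h, sum_comm, sum_powerset]
  refine sum_congr rfl fun k _ => ?_
  rw [degreeCoeff, sum_mul]
  refine sum_congr rfl fun T hT => ?_
  rw [(mem_powersetCard.1 hT).2, sum_mul]

lemma degreeCoeff_zero (ρ : ℝ) (A : Finset ℤ) (f : Cfg → ℝ) :
    degreeCoeff ρ A f 0 = phi A f ρ := by
  rw [phi_eq_sum_degreeCoeff ρ, sum_range_succ']
  simp

lemma degreeCoeff_one (ρ : ℝ) (A : Finset ℤ) (f : Cfg → ℝ) :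
    degreeCoeff ρ A f 1 = deriv (phi A f) ρ := by
  have h : HasDerivAt (fun β => ∑ k ∈ range (A.card + 1), degreeCoeff ρ A f k * (β - ρ) ^ k)
      (∑ k ∈ range (A.card + 1), degreeCoeff ρ A f k * (k * (ρ - ρ) ^ (k - 1) * 1)) ρ :=
    HasDerivAt.fun_sum fun k _ => (((hasDerivAt_id ρ).sub_const ρ).pow k).const_mul _
  rw [show phi A f = _ from funext (phi_eq_sum_degreeCoeff ρ A f), h.deriv, sum_range_succ']
  rcases Nat.eq_zero_or_pos A.card with h0 | h0
  · rw [card_eq_zero.1 h0]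
    simp [degreeCoeff, powersetCard_eq_empty.2 (show (∅ : Finset ℤ).card < 1 by simp)]
  · obtain ⟨n, hn⟩ := Nat.exists_eq_succ_of_ne_zero h0.ne'
    rw [hn, Nat.succ_eq_add_one, sum_range_succ']
    simp

lemma LocalOn.eq_sum {A : Finset ℤ} {f : Cfg → ℝ} (hf : LocalOn A f) (η : Cfg) :
    f η = ∑ S ∈ A.powerset,
      f (cfgOf S) * {ξ : Cfg | ∀ x ∈ A, ξ x = cfgOf S x}.indicator (fun _ => (1 : ℝ)) η := by
  have hmem : occupied A η ∈ A.powerset := mem_powerset.2 (filter_subset _ _)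
  rw [sum_eq_single_of_mem _ hmem]
  · have hη : η ∈ {ξ : Cfg | ∀ x ∈ A, ξ x = cfgOf (occupied A η) x} := fun x hx =>
      (cfgOf_occupied A η x hx).symm
    rw [Set.indicator_of_mem hη, mul_one]
    exact hf _ _ fun x hx => (cfgOf_occupied A η x hx).symm
  · intro S hS hne
    rw [Set.indicator_of_notMem, mul_zero]
    intro h
    apply hne
    ext x
    by_cases hx : x ∈ A
    · simp [occupied, hx, h x hx, cfgOf]
    · simpa [occupied, hx] using fun hxS => hx (mem_powerset.1 hS hxS)

lemma indicator_eq_prod (A S : Finset ℤ) (η : Cfg) :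
    {ξ : Cfg | ∀ x ∈ A, ξ x = cfgOf S x}.indicator (fun _ => (1 : ℝ)) η
      = ∏ x ∈ A, (if x ∈ S then (if η x then 1 else 0) else 1 - (if η x then 1 else 0)) := by
  by_cases h : ∀ x ∈ A, η x = cfgOf S x
  · rw [Set.indicator_of_mem (by exact h)]
    refine (prod_eq_one fun x hx => ?_).symm
    rw [h x hx]
    by_cases hS : x ∈ S <;> simp [cfgOf, hS]
  · rw [Set.indicator_of_notMem (by exact h)]
    push Not at h
    obtain ⟨x, hx, hne⟩ := h
    refine (prod_eq_zero hx ?_).symm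
    by_cases hS : x ∈ S <;> cases hη : η x <;> simp_all [cfgOf]

lemma LocalOn.eq_sum_centredOcc {A : Finset ℤ} {f : Cfg → ℝ} (hf : LocalOn A f) (ρ : ℝ) (η : Cfg) :
    f η = ∑ T ∈ A.powerset, (∑ S ∈ A.powerset, f (cfgOf S) * indicatorCoeff ρ A S T)
      * ∏ x ∈ T, centredOcc ρ η x := by
  have h : ∀ S ∈ A.powerset, f (cfgOf S) *
        {ξ : Cfg | ∀ x ∈ A, ξ x = cfgOf S x}.indicator (fun _ => (1 : ℝ)) η
      = ∑ T ∈ A.powerset, f (cfgOf S) * indicatorCoeff ρ A S T * ∏ x ∈ T, centredOcc ρ η x := by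
    intro S _
    have hz : ∀ x, (if η x then (1 : ℝ) else 0) = ρ + centredOcc ρ η x := by
      intro x
      rw [centredOcc]
      split_ifs <;> ring
    simp only [indicator_eq_prod, hz]
    rw [prod_indicator_eq_sum, mul_sum]
    exact sum_congr rfl fun T _ => by ring
  rw [hf.eq_sum η, sum_congr rfl h, sum_comm]
  exact sum_congr rfl fun T _ => by rw [sum_mul]

lemma sum_powersetCard_prod_ite (a b : ℝ) {A T : Finset ℤ} (hT : T ⊆ A) (m : ℕ) :
    ∑ S ∈ A.powersetCard m, ∏ x ∈ T, (if x ∈ S then a else b)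
      = (((Polynomial.C a * Polynomial.X + Polynomial.C b) ^ T.card
          * (Polynomial.X + 1) ^ (A.card - T.card)).coeff m) := by
  have h : ∏ x ∈ A, (Polynomial.C (if x ∈ T then a else 1) * Polynomial.X
        + Polynomial.C (if x ∈ T then b else 1))
      = (Polynomial.C a * Polynomial.X + Polynomial.C b) ^ T.card
          * (Polynomial.X + 1) ^ (A.card - T.card) := by
    rw [← prod_sdiff hT, mul_comm, ← card_sdiff_of_subset hT, ← prod_const, ← prod_const]
    congr 1
    · exact prod_congr rfl fun x hx => by simp [hx]
    · exact prod_congr rfl fun x hx => by simp [(mem_sdiff.1 hx).2]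
  rw [← h, prod_add, Polynomial.finsetSum_coeff, powersetCard_eq_filter, sum_filter]
  refine sum_congr rfl fun S hS => ?_
  have hS := mem_powerset.1 hS
  have hprod : ∏ x ∈ T, (if x ∈ S then a else b)
      = (∏ x ∈ S, if x ∈ T then a else 1) * ∏ x ∈ A \ S, if x ∈ T then b else 1 := by
    rw [prod_ite, prod_ite, prod_ite]
    simp only [prod_const_one, mul_one, filter_mem_eq_inter, filter_notMem_eq_sdiff]
    rw [inter_comm, show T \ S = (A \ S) ∩ T by ext x; have := @hT x; simp; tauto]
  rw [prod_mul_distrib, prod_const, ← map_prod, ← map_prod]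
  rw [show ∀ p q : ℝ, Polynomial.C p * Polynomial.X ^ S.card * Polynomial.C q
      = Polynomial.C (p * q) * Polynomial.X ^ S.card by
    intro p q; rw [Polynomial.C_mul]; ring]
  rw [Polynomial.coeff_C_mul_X_pow, ← hprod]
  simp only [eq_comm]

lemma sum_powersetCard_prod_ite_congr (a b : ℝ) {A S S' : Finset ℤ} (hS : S ⊆ A) (hS' : S' ⊆ A)
    (hcard : S.card = S'.card) (k : ℕ) :
    ∑ B ∈ A.powersetCard k, ∏ x ∈ B, (if x ∈ S then a else b)
      = ∑ B ∈ A.powersetCard k, ∏ x ∈ B, (if x ∈ S' then a else b) := by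
  have key : ∀ S ⊆ A, A.val.map (fun x => if x ∈ S then a else b)
      = Multiset.replicate S.card a + Multiset.replicate (A.card - S.card) b := by
    intro S hS
    have hA : A.val = S.val + (A \ S).val := by
      rw [sdiff_val, add_tsub_cancel_of_le (val_le_iff.2 hS)]
    rw [hA, Multiset.map_add, ← card_sdiff_of_subset hS]
    congr 1
    · refine Multiset.eq_replicate.2 ⟨by simp, fun y hy => ?_⟩
      obtain ⟨x, hx, rfl⟩ := Multiset.mem_map.1 hy
      exact if_pos hx
    · refine Multiset.eq_replicate.2 ⟨Multiset.card_map _ _, fun y hy => ?_⟩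
      obtain ⟨x, hx, rfl⟩ := Multiset.mem_map.1 hy
      exact if_neg (mem_sdiff.1 hx).2
  rw [← esymm_map_val, ← esymm_map_val, key S hS, key S' hS', hcard]

lemma centredOcc_cfgOf (ρ : ℝ) (S : Finset ℤ) (x : ℤ) :
    centredOcc ρ (cfgOf S) x = if x ∈ S then 1 - ρ else -ρ := by
  simp [centredOcc, cfgOf]

lemma centredEsymm_eq_of_occupied (ρ : ℝ) (A : Finset ℤ) (k : ℕ) (η : Cfg) :
    centredEsymm ρ A k η = centredEsymm ρ A k (cfgOf (occupied A η)) := by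
  refine sum_congr rfl fun B hB => prod_congr rfl fun x hx => ?_
  rw [centredOcc, centredOcc, cfgOf_occupied A η x ((mem_powersetCard.1 hB).1 hx)]

/-- Conditioning a product of centred occupations on the particle number symmetrizes it. -/
lemma condAvg_prod_centredOcc (ρ : ℝ) (ℓ : ℕ) {T : Finset ℤ} (hT : T ⊆ Icc 1 (ℓ : ℤ)) (η : Cfg) :
    condAvg ℓ (numOnes ℓ η) (fun ξ => ∏ x ∈ T, centredOcc ρ ξ x)
      = centredEsymm ρ (Icc 1 (ℓ : ℤ)) T.card η / (ℓ.choose T.card : ℝ) := by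
  set A := Icc 1 (ℓ : ℤ) with hA
  have hAc : A.card = ℓ := by simp [hA]
  set S₀ := occupied A η with hS₀
  have hS₀A : S₀ ⊆ A := filter_subset _ _
  have hTl : T.card ≤ ℓ := hAc ▸ card_le_card hT
  have hSl : S₀.card ≤ ℓ := hAc ▸ card_le_card hS₀A
  have hT0 : (ℓ.choose T.card : ℝ) ≠ 0 := by exact_mod_cast (Nat.choose_pos hTl).ne'
  have hS0 : (ℓ.choose S₀.card : ℝ) ≠ 0 := by exact_mod_cast (Nat.choose_pos hSl).ne'
  rw [condAvg, ← card_occupied, ← hA, ← hS₀, ← powersetCard_eq_filter,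
    centredEsymm_eq_of_occupied, ← hS₀, centredEsymm, div_eq_div_iff hS0 hT0]
  simp only [centredOcc_cfgOf]
  have h1 : ∑ B ∈ A.powersetCard T.card, ∑ S ∈ A.powersetCard S₀.card,
        ∏ x ∈ B, (if x ∈ S then 1 - ρ else -ρ)
      = ℓ.choose T.card *
        ∑ S ∈ A.powersetCard S₀.card, ∏ x ∈ T, (if x ∈ S then 1 - ρ else -ρ) := by
    rw [sum_congr rfl (g := fun _ => ∑ S ∈ A.powersetCard S₀.card,
      ∏ x ∈ T, (if x ∈ S then 1 - ρ else -ρ)), sum_const, card_powersetCard, hAc, nsmul_eq_mul]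
    intro B hB
    obtain ⟨hBA, hBc⟩ := mem_powersetCard.1 hB
    rw [sum_powersetCard_prod_ite _ _ hBA, sum_powersetCard_prod_ite _ _ hT, hBc]
  have h2 : ∑ S ∈ A.powersetCard S₀.card, ∑ B ∈ A.powersetCard T.card,
        ∏ x ∈ B, (if x ∈ S then 1 - ρ else -ρ)
      = ℓ.choose S₀.card *
        ∑ B ∈ A.powersetCard T.card, ∏ x ∈ B, (if x ∈ S₀ then 1 - ρ else -ρ) := by
    rw [sum_congr rfl (g := fun _ => ∑ B ∈ A.powersetCard T.card,
      ∏ x ∈ B, (if x ∈ S₀ then 1 - ρ else -ρ)), sum_const, card_powersetCard, hAc, nsmul_eq_mul]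
    intro S hS
    obtain ⟨hSA, hSc⟩ := mem_powersetCard.1 hS
    exact sum_powersetCard_prod_ite_congr _ _ hSA hS₀A hSc _
  rw [sum_comm, h1] at h2
  linarith

lemma psiFun_eq_sum (ρ : ℝ) {ℓ₀ ℓ : ℕ} (hℓ : ℓ₀ ≤ ℓ) {f : Cfg → ℝ}
    (hf : LocalOn (Icc 1 (ℓ₀ : ℤ)) f) (η : Cfg) :
    psiFun ℓ f η = ∑ k ∈ range (ℓ₀ + 1), degreeCoeff ρ (Icc 1 (ℓ₀ : ℤ)) f k / (ℓ.choose k : ℝ)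
      * centredEsymm ρ (Icc 1 (ℓ : ℤ)) k η := by
  set A := Icc 1 (ℓ₀ : ℤ) with hA
  have hAc : A.card = ℓ₀ := by simp [hA]
  have hAl : A ⊆ Icc 1 (ℓ : ℤ) := Icc_subset_Icc_right (by exact_mod_cast hℓ)
  have h1 : psiFun ℓ f η = ∑ T ∈ A.powerset,
      (∑ S ∈ A.powerset, f (cfgOf S) * indicatorCoeff ρ A S T)
        * condAvg ℓ (numOnes ℓ η) (fun ξ => ∏ x ∈ T, centredOcc ρ ξ x) := by
    simp only [psiFun, condAvg]
    simp_rw [← mul_div_assoc, mul_sum, ← sum_div]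
    rw [sum_comm]
    congr 1
    refine sum_congr rfl fun S' _ => ?_
    exact hf.eq_sum_centredOcc ρ (cfgOf S')
  rw [h1, sum_powerset, hAc]
  refine sum_congr rfl fun k _ => ?_
  rw [degreeCoeff, sum_div, sum_mul]
  refine sum_congr rfl fun T hT => ?_
  obtain ⟨hTA, hTc⟩ := mem_powersetCard.1 hT
  rw [condAvg_prod_centredOcc ρ ℓ (hTA.trans hAl), hTc]
  ring

lemma measurableSet_cylinder (A : Finset ℤ) (σ : Cfg) :
    MeasurableSet {η : Cfg | ∀ x ∈ A, η x = σ x} := by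
  have : {η : Cfg | ∀ x ∈ A, η x = σ x} = ⋂ x ∈ A, (fun η : Cfg => η x) ⁻¹' {σ x} := by
    ext; simp
  rw [this]
  exact A.measurableSet_biInter fun x _ => measurable_pi_apply x (MeasurableSet.singleton _)

lemma LocalOn.integrable {A : Finset ℤ} {g : Cfg → ℝ} (hg : LocalOn A g) (μ : Measure Cfg)
    [IsProbabilityMeasure μ] : Integrable g μ := by
  rw [funext hg.eq_sum]
  exact integrable_finsetSum _ fun S _ =>
    ((integrable_const _).indicator (measurableSet_cylinder A _)).const_mul _

lemma IsBernoulliProduct.integral_eq_sum {ρ : ℝ} {μ : Measure Cfg} (hμ : IsBernoulliProduct ρ μ)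
    {A : Finset ℤ} {g : Cfg → ℝ} (hg : LocalOn A g) :
    ∫ η, g η ∂μ = ∑ S ∈ A.powerset, g (cfgOf S) * ∏ x ∈ A, (if x ∈ S then ρ else 1 - ρ) := by
  have := hμ.1
  rw [integral_congr_ae (Filter.Eventually.of_forall hg.eq_sum), integral_finsetSum _ fun S _ =>
    ((integrable_const _).indicator (measurableSet_cylinder A _)).const_mul _]
  refine sum_congr rfl fun S _ => ?_
  rw [integral_const_mul, integral_indicator_const _ (measurableSet_cylinder A _), Measure.real,
    hμ.2 A (cfgOf S), smul_eq_mul, mul_one]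
  simp [cfgOf]

lemma IsBernoulliProduct.integral_prod {ρ : ℝ} {μ : Measure Cfg} (hμ : IsBernoulliProduct ρ μ)
    (A : Finset ℤ) (h : ℤ → Bool → ℝ) :
    ∫ η, ∏ x ∈ A, h x (η x) ∂μ = ∏ x ∈ A, (ρ * h x true + (1 - ρ) * h x false) := by
  have hloc : LocalOn A (fun η => ∏ x ∈ A, h x (η x)) := fun η ξ hηξ =>
    prod_congr rfl fun x hx => by rw [hηξ x hx]
  rw [hμ.integral_eq_sum hloc, prod_add]
  refine sum_congr rfl fun S hS => ?_
  have hS := mem_powerset.1 hS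
  rw [← prod_mul_distrib, ← prod_sdiff hS, mul_comm]
  congr 1
  · exact prod_congr rfl fun x hx => by simp [cfgOf, hx, mul_comm]
  · exact prod_congr rfl fun x hx => by simp [cfgOf, (mem_sdiff.1 hx).2, mul_comm]

lemma IsBernoulliProduct.integral_centredOcc_mul {ρ : ℝ} {μ : Measure Cfg}
    (hμ : IsBernoulliProduct ρ μ) (B C : Finset ℤ) :
    ∫ η, (∏ x ∈ B, centredOcc ρ η x) * ∏ x ∈ C, centredOcc ρ η x ∂μ
      = if B = C then (ρ * (1 - ρ)) ^ B.card else 0 := by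
  set v : Bool → ℝ := fun b => if b then 1 - ρ else -ρ with hv
  have h : ∀ η : Cfg, (∏ x ∈ B, centredOcc ρ η x) * ∏ x ∈ C, centredOcc ρ η x
      = ∏ x ∈ B ∪ C, (fun x b => (if x ∈ B then v b else 1) * if x ∈ C then v b else 1) x (η x) := by
    intro η
    simp only [prod_mul_distrib]
    rw [prod_ite_mem, prod_ite_mem, union_inter_cancel_left, union_inter_cancel_right]
    rfl
  simp_rw [h]
  rw [hμ.integral_prod (B ∪ C)
    (fun x b => (if x ∈ B then v b else 1) * if x ∈ C then v b else 1)]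
  split_ifs with hBC
  · subst hBC
    rw [union_self, ← prod_const]
    refine prod_congr rfl fun x hx => ?_
    simp [hx, hv]
    ring
  · have : ∃ x ∈ B ∪ C, ¬ (x ∈ B ↔ x ∈ C) := by
      by_contra! hcon
      exact hBC (Finset.ext fun x => by have := hcon x; rw [mem_union] at this; tauto)
    obtain ⟨x, hx, hne⟩ := this
    refine prod_eq_zero hx ?_
    by_cases h1 : x ∈ B <;> by_cases h2 : x ∈ C <;> simp_all <;> ring

lemma localOn_prod_centredOcc (ρ : ℝ) {A B : Finset ℤ} (hB : B ⊆ A) :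
    LocalOn A (fun η => ∏ x ∈ B, centredOcc ρ η x) := fun η ξ h =>
  prod_congr rfl fun x hx => by rw [centredOcc, centredOcc, h x (hB hx)]

lemma localOn_centredEsymm (ρ : ℝ) (A : Finset ℤ) (k : ℕ) : LocalOn A (centredEsymm ρ A k) :=
  fun η ξ h => sum_congr rfl fun _ hB =>
    localOn_prod_centredOcc ρ (mem_powersetCard.1 hB).1 η ξ h

lemma IsBernoulliProduct.integral_centredEsymm_sq {ρ : ℝ} {μ : Measure Cfg}
    (hμ : IsBernoulliProduct ρ μ) (A : Finset ℤ) (k : ℕ) :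
    ∫ η, centredEsymm ρ A k η ^ 2 ∂μ = A.card.choose k * (ρ * (1 - ρ)) ^ k := by
  have := hμ.1
  have hint : ∀ B ∈ A.powersetCard k, ∀ C ∈ A.powersetCard k,
      Integrable (fun η => (∏ x ∈ B, centredOcc ρ η x) * ∏ x ∈ C, centredOcc ρ η x) μ := by
    intro B hB C hC
    refine LocalOn.integrable (A := A) (fun η ξ h => ?_) μ
    exact congrArg₂ (· * ·) (localOn_prod_centredOcc ρ (mem_powersetCard.1 hB).1 η ξ h)
      (localOn_prod_centredOcc ρ (mem_powersetCard.1 hC).1 η ξ h)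
  simp_rw [centredEsymm, sq, sum_mul_sum]
  rw [integral_finsetSum _ fun B hB => integrable_finsetSum _ (hint B hB)]
  rw [sum_congr rfl (g := fun _ => (ρ * (1 - ρ)) ^ k), sum_const, card_powersetCard, nsmul_eq_mul]
  intro B hB
  rw [integral_finsetSum _ (hint B hB)]
  simp_rw [hμ.integral_centredOcc_mul]
  rw [sum_ite_eq, if_pos hB, (mem_powersetCard.1 hB).2]

lemma localOn_psiFun {ℓ ℓ' : ℕ} (hℓ : ℓ ≤ ℓ') (f : Cfg → ℝ) :
    LocalOn (Icc 1 (ℓ' : ℤ)) (psiFun ℓ f) := by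
  intro η ξ h
  have : numOnes ℓ η = numOnes ℓ ξ := sum_congr rfl fun x hx => by
    rw [h x (Icc_subset_Icc_right (by exact_mod_cast hℓ) hx)]
  rw [psiFun, psiFun, this]

lemma IsBernoulliProduct.integral_psiFun_sq_le {ρ : ℝ} {μ : Measure Cfg}
    (hμ : IsBernoulliProduct ρ μ) {ℓ₀ ℓ : ℕ} (hℓ : ℓ₀ ≤ ℓ) {f : Cfg → ℝ}
    (hf : LocalOn (Icc 1 (ℓ₀ : ℤ)) f) :
    ∫ η, psiFun ℓ f η ^ 2 ∂μ ≤ (ℓ₀ + 1) * ∑ k ∈ range (ℓ₀ + 1),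
      degreeCoeff ρ (Icc 1 (ℓ₀ : ℤ)) f k ^ 2 * ((ρ * (1 - ρ)) ^ k / (ℓ.choose k : ℝ)) := by
  have := hμ.1
  set A := Icc 1 (ℓ : ℤ) with hA
  set F := degreeCoeff ρ (Icc 1 (ℓ₀ : ℤ)) f with hF
  have hAc : A.card = ℓ := by simp [hA]
  have hterm : ∀ k ∈ range (ℓ₀ + 1),
      Integrable (fun η => (F k / (ℓ.choose k : ℝ)) ^ 2 * centredEsymm ρ A k η ^ 2) μ := by
    intro k _
    refine LocalOn.integrable (A := A) (fun η ξ h => ?_) μ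
    simp only [localOn_centredEsymm ρ A k η ξ h]
  calc ∫ η, psiFun ℓ f η ^ 2 ∂μ
      ≤ ∫ η, (ℓ₀ + 1) * ∑ k ∈ range (ℓ₀ + 1),
          (F k / (ℓ.choose k : ℝ)) ^ 2 * centredEsymm ρ A k η ^ 2 ∂μ := by
        refine integral_mono (LocalOn.integrable (A := A) (fun η ξ h => ?_) μ)
          ((integrable_finsetSum _ hterm).const_mul _) fun η => ?_
        · simp only [localOn_psiFun le_rfl f η ξ h]
        · simp only [psiFun_eq_sum ρ hℓ hf]
          refine sq_sum_le_card_mul_sum_sq.trans (le_of_eq ?_)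
          simp [mul_pow, hF, hA]
    _ = _ := by
        rw [integral_const_mul, integral_finsetSum _ hterm]
        congr 1
        refine sum_congr rfl fun k hk => ?_
        rw [integral_const_mul, hμ.integral_centredEsymm_sq, hAc]
        have : (ℓ.choose k : ℝ) ≠ 0 := by
          exact_mod_cast (Nat.choose_pos (by have := mem_range.1 hk; omega)).ne'
        field_simp

lemma pow_le_mul_choose {ℓ₀ ℓ k : ℕ} (hk : 1 ≤ k) (hkℓ₀ : k ≤ ℓ₀) (hℓ : ℓ₀ ≤ ℓ) :
    ℓ ^ k ≤ ℓ₀ ^ ℓ₀ * ℓ₀.factorial * ℓ.choose k := by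
  have h1 : ℓ ≤ k * (ℓ + 1 - k) := by
    obtain ⟨d, rfl⟩ := Nat.exists_eq_add_of_le (hkℓ₀.trans hℓ)
    rw [show k + d + 1 - k = d + 1 by omega]
    nlinarith
  have h2 : (ℓ + 1 - k) ^ k ≤ k.factorial * ℓ.choose k := by
    rw [← Nat.descFactorial_eq_factorial_mul_choose]
    exact Nat.pow_sub_le_descFactorial ℓ k
  have h3 : k ^ k ≤ ℓ₀ ^ ℓ₀ :=
    (Nat.pow_le_pow_left hkℓ₀ k).trans (Nat.pow_le_pow_right (by omega) hkℓ₀)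
  calc ℓ ^ k ≤ (k * (ℓ + 1 - k)) ^ k := Nat.pow_le_pow_left h1 k
    _ = k ^ k * (ℓ + 1 - k) ^ k := mul_pow _ _ _
    _ ≤ ℓ₀ ^ ℓ₀ * (ℓ₀.factorial * ℓ.choose k) := by
        refine Nat.mul_le_mul h3 (h2.trans ?_)
        exact Nat.mul_le_mul_right _ (Nat.factorial_le hkℓ₀)
    _ = _ := by ring

/-- If the coefficients of `f` of degree less than `j` vanish, then `E[ψ_f(ℓ)²] = O(ℓ⁻ʲ)`. -/
lemma IsBernoulliProduct.integral_psiFun_sq_le_div_pow {ρ : ℝ} (hρ : ρ ∈ Set.Ioo (0 : ℝ) 1)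
    {μ : Measure Cfg} (hμ : IsBernoulliProduct ρ μ) {ℓ₀ ℓ : ℕ} (hℓ : ℓ₀ ≤ ℓ) (hpos : 0 < ℓ)
    {f : Cfg → ℝ} (hf : LocalOn (Icc 1 (ℓ₀ : ℤ)) f) {j : ℕ} (hj : 1 ≤ j)
    (hF : ∀ k < j, degreeCoeff ρ (Icc 1 (ℓ₀ : ℤ)) f k = 0) :
    ∫ η, psiFun ℓ f η ^ 2 ∂μ ≤ ((ℓ₀ + 1) * (∑ k ∈ range (ℓ₀ + 1),
      degreeCoeff ρ (Icc 1 (ℓ₀ : ℤ)) f k ^ 2) * (ℓ₀ ^ ℓ₀ * ℓ₀.factorial)) / (ℓ : ℝ) ^ j := by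
  refine (hμ.integral_psiFun_sq_le hℓ hf).trans ?_
  rw [mul_assoc, mul_div_assoc, sum_mul, sum_div]
  refine mul_le_mul_of_nonneg_left (sum_le_sum fun k hk => ?_) (by positivity)
  rcases lt_or_ge k j with hkj | hkj
  · simp [hF k hkj]
  rw [mul_div_assoc]
  refine mul_le_mul_of_nonneg_left ?_ (sq_nonneg _)
  have hk₀ : k ≤ ℓ₀ := by have := mem_range.1 hk; omega
  have hc : (0 : ℝ) < ℓ.choose k := by exact_mod_cast Nat.choose_pos (hk₀.trans hℓ)
  have hℓ' : (1 : ℝ) ≤ ℓ := by exact_mod_cast hpos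
  have hv : (ρ * (1 - ρ)) ^ k ≤ 1 :=
    pow_le_one₀ (mul_nonneg hρ.1.le (by linarith [hρ.2])) (by nlinarith [hρ.1, hρ.2])
  rw [div_le_div_iff₀ hc (by positivity)]
  calc (ρ * (1 - ρ)) ^ k * (ℓ : ℝ) ^ j ≤ 1 * (ℓ : ℝ) ^ k := by
        gcongr
    _ ≤ _ := by
        rw [one_mul]
        exact_mod_cast pow_le_mul_choose (hj.trans hkj) hk₀ hℓ

lemma Var_le_integral_sq {A : Finset ℤ} {g : Cfg → ℝ} (hg : LocalOn A g) (μ : Measure Cfg)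
    [IsProbabilityMeasure μ] : Var μ g ≤ ∫ η, g η ^ 2 ∂μ := by
  set m := ∫ ξ, g ξ ∂μ with hm
  have hsq : Integrable (fun η => g η ^ 2) μ :=
    LocalOn.integrable (A := A) (fun η ξ h => by simp only [hg η ξ h]) μ
  have h : ∀ η, (g η - m) ^ 2 = g η ^ 2 - 2 * m * g η + m ^ 2 := fun η => by ring
  have hlin : Integrable (fun η => 2 * m * g η) μ := (hg.integrable μ).const_mul _
  rw [Var, ← hm]
  simp_rw [h]
  rw [integral_add (f := fun η => g η ^ 2 - 2 * m * g η) (hsq.sub hlin) (integrable_const _),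
    integral_sub hsq hlin, integral_const_mul,
    ← hm, integral_const, probReal_univ, one_smul]
  nlinarith [sq_nonneg m]

lemma Var_sub_le {A : Finset ℤ} {g h : Cfg → ℝ} (hg : LocalOn A g) (hh : LocalOn A h)
    (μ : Measure Cfg) [IsProbabilityMeasure μ] :
    Var μ (fun η => g η - h η) ≤ 2 * ∫ η, g η ^ 2 ∂μ + 2 * ∫ η, h η ^ 2 ∂μ := by
  have hloc : LocalOn A (fun η => g η - h η) := fun η ξ e => by simp only [hg η ξ e, hh η ξ e]
  have hg2 : Integrable (fun η => 2 * g η ^ 2) μ :=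
    LocalOn.integrable (A := A) (fun η ξ e => by simp only [hg η ξ e]) μ
  have hh2 : Integrable (fun η => 2 * h η ^ 2) μ :=
    LocalOn.integrable (A := A) (fun η ξ e => by simp only [hh η ξ e]) μ
  refine (Var_le_integral_sq hloc μ).trans ?_
  rw [← integral_const_mul, ← integral_const_mul, ← integral_add hg2 hh2]
  refine integral_mono
    (LocalOn.integrable (A := A) (fun η ξ e => by simp only [hg η ξ e, hh η ξ e]) μ)
    (hg2.add hh2) fun η => ?_
  simp only
  nlinarith [sq_nonneg (g η + h η)]

lemma IsBernoulliProduct.Var_psiFun_sub_le {ρ : ℝ} (hρ : ρ ∈ Set.Ioo (0 : ℝ) 1)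
    {μ : Measure Cfg} (hμ : IsBernoulliProduct ρ μ) {ℓ₀ ℓ : ℕ} (hℓ : ℓ₀ ≤ ℓ)
    {f : Cfg → ℝ} (hf : LocalOn (Icc 1 (ℓ₀ : ℤ)) f) {j : ℕ} (hj : 1 ≤ j)
    (hF : ∀ k < j, degreeCoeff ρ (Icc 1 (ℓ₀ : ℤ)) f k = 0) :
    Var μ (fun η => psiFun ℓ f η - psiFun (2 * ℓ) f η) ≤
      (4 * ((ℓ₀ + 1) * (∑ k ∈ range (ℓ₀ + 1),
        degreeCoeff ρ (Icc 1 (ℓ₀ : ℤ)) f k ^ 2) * (ℓ₀ ^ ℓ₀ * ℓ₀.factorial))) / (ℓ : ℝ) ^ j := by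
  have := hμ.1
  rcases Nat.eq_zero_or_pos ℓ with rfl | hpos
  · simp [Var, show j ≠ 0 by omega]
  have h1 := hμ.integral_psiFun_sq_le_div_pow hρ hℓ hpos hf hj hF
  have h2 := hμ.integral_psiFun_sq_le_div_pow hρ (ℓ := 2 * ℓ) (by omega) (by omega) hf hj hF
  have h3 := Var_sub_le (localOn_psiFun (show ℓ ≤ 2 * ℓ by omega) f)
    (localOn_psiFun (le_refl (2 * ℓ)) f) μ
  set K : ℝ := (ℓ₀ + 1) * (∑ k ∈ range (ℓ₀ + 1),
    degreeCoeff ρ (Icc 1 (ℓ₀ : ℤ)) f k ^ 2) * (ℓ₀ ^ ℓ₀ * ℓ₀.factorial) with hK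
  have hK0 : 0 ≤ K := by positivity
  have h4 : K / ((2 * ℓ : ℕ) : ℝ) ^ j ≤ K / (ℓ : ℝ) ^ j := by
    have : (0 : ℝ) < ℓ := by exact_mod_cast hpos
    gcongr
    omega
  rw [mul_div_assoc]
  linarith

/-- **Renormalization variance bound for doubled blocks.** If `f` is local with support
in `{1,…,ℓ₀}`, `ρ ∈ (0,1)` and `φ_f(ρ) = 0`, then there is a constant `c = c(f,ρ)` such
that for every `ℓ ≥ ℓ₀`, `Var(ψ_f(ℓ) − ψ_f(2ℓ); ν_ρ) ≤ c/ℓ`; and if in addition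
`φ_f'(ρ) = 0`, then `Var(ψ_f(ℓ) − ψ_f(2ℓ); ν_ρ) ≤ c/ℓ²`. -/
theorem renormalization_variance_bound
    (ℓ₀ : ℕ) (f : Cfg → ℝ) (hf : LocalOn (Finset.Icc (1 : ℤ) (ℓ₀ : ℤ)) f)
    (ρ : ℝ) (hρ : ρ ∈ Set.Ioo (0 : ℝ) 1)
    (hφ : phi (Finset.Icc (1 : ℤ) (ℓ₀ : ℤ)) f ρ = 0) :
    ∃ c : ℝ, ∀ μ : Measure Cfg, IsBernoulliProduct ρ μ → ∀ ℓ : ℕ, ℓ₀ ≤ ℓ →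
      Var μ (fun η => psiFun ℓ f η - psiFun (2 * ℓ) f η) ≤ c / (ℓ : ℝ)
        ∧ (deriv (phi (Finset.Icc (1 : ℤ) (ℓ₀ : ℤ)) f) ρ = 0 →
            Var μ (fun η => psiFun ℓ f η - psiFun (2 * ℓ) f η) ≤ c / (ℓ : ℝ) ^ 2) := by
  have h0 := (degreeCoeff_zero ρ (Icc 1 (ℓ₀ : ℤ)) f).trans hφ
  refine ⟨_, fun μ hμ ℓ hℓ => ⟨?_, fun hd => hμ.Var_psiFun_sub_le hρ hℓ hf one_le_two ?_⟩⟩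
  · rw [← pow_one (ℓ : ℝ)]
    refine hμ.Var_psiFun_sub_le hρ hℓ hf le_rfl fun k hk => ?_
    rwa [Nat.lt_one_iff.1 hk]
  · intro k hk
    interval_cases k
    · exact h0
    · exact (degreeCoeff_one ρ _ f).trans hd
end
end
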